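/- Suppose the coefficients B, C_j, D_j, Q, R are constant in time, and for each T > 0 let P^{(T)} denote the unique mild solution on [0,T] of the Riccati equation with terminal value 0 satisfying the singular bound. Then the solution is non-decreasing in the horizon: for all 0 < T₁ ≤ T₂ and every t ∈ [0,T₁], P^{(T₁)}_t ≤ P^{(T₂)}_t. -/

import Mathlib

open scoped RealInnerProductSpace
open Filter MeasureTheory

/-- For time-invariant coefficients: `P` is a mild solution on `[0,T]` of the Riccati
equation with terminal value `0`, i.e. a strongly continuous family in `𝒮⁺(H)` with
`∑_j ⟨P_s C_j x, C_j x⟩ < ∞` for `s ∈ [0,T)`, such that with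
`Λ(P_s) = R + ∑_j D_j* P_s D_j` and `λ(P_s) = −Λ(P_s)⁻¹(B* P_s + ∑_j D_j* P_s C_j)`
(the sum being the strong limit of its partial sums), for all `t ∈ [0,T]`, `x, y ∈ H`:
`⟨P_t x, y⟩ = ∫_t^T ⟨(∑_j C_j* P_s C_j + Q − λ(P_s)* Λ(P_s) λ(P_s)) e^{(s−t)A}x,
e^{(s−t)A}y⟩ ds`. -/
def IsRiccatiMildSolutionTI
    {H U : Type*}
    [NormedAddCommGroup H] [InnerProductSpace ℝ H] [CompleteSpace H]
    [NormedAddCommGroup U] [InnerProductSpace ℝ U] [CompleteSpace U]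
    (T : ℝ) (S : ℝ → H →L[ℝ] H)
    (B : U →L[ℝ] H) (C : ℕ → H →L[ℝ] H) (D : ℕ → U →L[ℝ] H)
    (Q : H →L[ℝ] H) (R : U →L[ℝ] U) (P : ℝ → H →L[ℝ] H) : Prop :=
  (∀ t ∈ Set.Icc (0 : ℝ) T, IsSelfAdjoint (P t) ∧ ∀ x : H, 0 ≤ ⟪P t x, x⟫) ∧
  (∀ x : H, ContinuousOn (fun t => P t x) (Set.Icc (0 : ℝ) T)) ∧
  (∀ s ∈ Set.Ico (0 : ℝ) T, ∀ x : H, Summable fun j => ⟪P s (C j x), C j x⟫) ∧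
  ∃ (Λ : ℝ → U →L[ℝ] U) (lam : ℝ → H →L[ℝ] U),
    (∀ s ∈ Set.Ico (0 : ℝ) T, ∀ v w : U,
      ⟪Λ s v, w⟫ = ⟪R v, w⟫ + ∑' j, ⟪P s (D j v), D j w⟫) ∧
    (∀ s ∈ Set.Ico (0 : ℝ) T, ∀ x : H,
      Tendsto (fun N => ∑ j ∈ Finset.range N,
          (ContinuousLinearMap.adjoint (D j)) (P s (C j x))) atTop
        (nhds (-(Λ s (lam s x)) - (ContinuousLinearMap.adjoint B) (P s x)))) ∧
    (∀ t ∈ Set.Icc (0 : ℝ) T, ∀ x y : H,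
      ⟪P t x, y⟫
        = ∫ s in t..T,
            ((∑' j, ⟪P s (C j (S (s - t) x)), C j (S (s - t) y)⟫)
              + ⟪Q (S (s - t) x), S (s - t) y⟫
              - ⟪Λ s (lam s (S (s - t) x)), lam s (S (s - t) y)⟫))

/-- The singular bound `‖∑_j C_j* P_s C_j‖ ≤ K (T−s)^{−2α}` on `[0,T)`, expressed through
the (nonnegative) quadratic form of the operator `∑_j C_j* P_s C_j`. -/
def RiccatiSingularBoundTI
    {H : Type*} [NormedAddCommGroup H] [InnerProductSpace ℝ H] [CompleteSpace H]
    (T α : ℝ) (C : ℕ → H →L[ℝ] H) (P : ℝ → H →L[ℝ] H) : Prop :=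
  ∃ K : ℝ, ∀ s ∈ Set.Ico (0 : ℝ) T, ∀ x : H,
    (∑' j, ⟪P s (C j x), C j x⟫) ≤ K * (T - s) ^ (-2 * α) * ‖x‖ ^ 2


/-- A backward Gronwall-type inequality: the damping term `-(a * f)` can only help. -/
theorem neg_integral_le_of_backward_inequality {f g Y : ℝ → ℝ} {t T a : ℝ} (htT : t ≤ T)
    (ha : 0 ≤ a) (hg : IntervalIntegrable g volume t T) (hY : IntervalIntegrable Y volume t T)
    (hY0 : ∀ s ∈ Set.Ico t T, 0 ≤ Y s)
    (hf : ∀ s ∈ Set.Icc t T, f s = f T + ∫ r in s..T, g r) (hfT : 0 ≤ f T)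
    (hineq : ∀ s ∈ Set.Ico t T, -(a * f s) - Y s ≤ g s) :
    -∫ s in t..T, Y s ≤ f t := by
  have hgY := hg.add hY
  set φ : ℝ → ℝ := fun s => f T + ∫ r in s..T, (g r + Y r) with hφ
  have sub : ∀ {u : ℝ → ℝ}, IntervalIntegrable u volume t T → ∀ s ∈ Set.Icc t T,
      IntervalIntegrable u volume s T := fun hu s hs =>
    hu.mono_set (by rw [Set.uIcc_of_le htT, Set.uIcc_of_le hs.2]; exact Set.Icc_subset_Icc_left hs.1)
  have hφf : ∀ s ∈ Set.Icc t T, φ s = f s + ∫ r in s..T, Y r := by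
    intro s hs
    rw [hφ, hf s hs]
    simp only
    rw [intervalIntegral.integral_add (sub hg s hs) (sub hY s hs)]
    ring
  have hφc : ContinuousOn φ (Set.Icc t T) := by
    have h := intervalIntegral.continuousOn_primitive_interval_left
      (f := fun r => g r + Y r) (a := t) (b := T) (μ := volume) (by
        have := (intervalIntegrable_iff_integrableOn_Icc_of_le htT).1 hgY
        rw [Set.uIcc_of_le htT]; exact this)
    rw [Set.uIcc_of_le htT] at h
    exact continuousOn_const.add h
  have hYint : ∀ s ∈ Set.Icc t T, 0 ≤ ∫ r in s..T, Y r := by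
    intro s hs
    rw [intervalIntegral.integral_of_le hs.2, ← integral_Ico_eq_integral_Ioc]
    exact setIntegral_nonneg measurableSet_Ico fun r hr => hY0 r ⟨hs.1.trans hr.1, hr.2⟩
  by_contra hcon
  have hneg : φ t < 0 := by
    rw [hφf t ⟨le_rfl, htT⟩]; linarith
  have hZc : IsCompact (Set.Icc t T ∩ φ ⁻¹' Set.Ici 0) := by
    exact isCompact_Icc.of_isClosed_subset (hφc.preimage_isClosed_of_isClosed isClosed_Icc isClosed_Ici)
      Set.inter_subset_left
  have hZne : (Set.Icc t T ∩ φ ⁻¹' Set.Ici 0).Nonempty :=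
    ⟨T, ⟨htT, le_rfl⟩, by simpa [hφ] using hfT⟩
  obtain ⟨b, ⟨hbI, hb0⟩, hbmin⟩ := hZc.exists_isLeast hZne
  have hbefore : ∀ s ∈ Set.Ico t b, 0 ≤ g s + Y s := by
    intro s hs
    have hsI : s ∈ Set.Icc t T := ⟨hs.1, hs.2.le.trans hbI.2⟩
    have h1 : φ s < 0 := by
      by_contra h
      exact absurd (hbmin ⟨hsI, not_lt.1 h⟩) (not_le.2 hs.2)
    have h2 := hφf s hsI
    have h3 := hYint s hsI
    have h4 := hineq s ⟨hs.1, hs.2.trans_le hbI.2⟩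
    nlinarith
  have hsplit : φ t = φ b + ∫ r in t..b, (g r + Y r) := by
    have h1 : IntervalIntegrable (fun r => g r + Y r) volume t b :=
      hgY.mono_set (by
        rw [Set.uIcc_of_le htT, Set.uIcc_of_le hbI.1]; exact Set.Icc_subset_Icc_right hbI.2)
    have := intervalIntegral.integral_add_adjacent_intervals h1 (sub hgY b hbI)
    simp only [hφ]
    linarith
  have hpos : 0 ≤ ∫ r in t..b, (g r + Y r) := by
    rw [intervalIntegral.integral_of_le hbI.1, ← integral_Ico_eq_integral_Ioc]
    exact setIntegral_nonneg measurableSet_Ico hbefore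
  have hb0' : 0 ≤ φ b := hb0
  linarith

theorem intervalIntegrable_sub_rpow {p s T : ℝ} (hp : -1 < p) :
    IntervalIntegrable (fun r => (r - s) ^ p) volume s T := by
  have := (intervalIntegral.intervalIntegrable_rpow' (a := 0) (b := T - s) hp).comp_sub_right s
  simpa using this

theorem intervalIntegrable_rsub_rpow {p s T : ℝ} (hp : -1 < p) :
    IntervalIntegrable (fun r => (T - r) ^ p) volume s T := by
  have := (intervalIntegral.intervalIntegrable_rpow' (a := T - s) (b := 0) hp).comp_sub_left T
  simpa using this

theorem rpow_mul_rpow_le_of_neg {p a b : ℝ} (hp : p ≤ 0) (ha : 0 < a) (hb : 0 < b) :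
    a ^ p * b ^ p ≤ ((a + b) / 2) ^ p * (a ^ p + b ^ p) := by
  have hap := Real.rpow_nonneg ha.le p
  have hbp := Real.rpow_nonneg hb.le p
  have hm := Real.rpow_nonneg (show 0 ≤ (a + b) / 2 by positivity) p
  rcases le_total a b with h | h
  · have : b ^ p ≤ ((a + b) / 2) ^ p :=
      Real.rpow_le_rpow_of_nonpos (by positivity) (by linarith) hp
    nlinarith [mul_nonneg hm hbp]
  · have : a ^ p ≤ ((a + b) / 2) ^ p :=
      Real.rpow_le_rpow_of_nonpos (by positivity) (by linarith) hp
    nlinarith [mul_nonneg hm hap]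

theorem intervalIntegrable_rpow_mul_rpow {p s T : ℝ} (hp : -1 < p) (hp0 : p ≤ 0) (hsT : s < T) :
    IntervalIntegrable (fun r => (T - r) ^ p * (r - s) ^ p) volume s T := by
  have h := ((intervalIntegrable_rsub_rpow (s := s) (T := T) hp).add
    (intervalIntegrable_sub_rpow (s := s) (T := T) hp)).const_mul (((T - s) / 2) ^ p)
  rw [intervalIntegrable_iff_integrableOn_Ioo_of_le hsT.le] at h ⊢
  refine Integrable.mono' h (by fun_prop) ?_
  filter_upwards [ae_restrict_mem measurableSet_Ioo] with r hr
  have h1 : 0 < T - r := sub_pos.2 hr.2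
  have h2 : 0 < r - s := sub_pos.2 hr.1
  rw [Real.norm_of_nonneg (by positivity)]
  have := rpow_mul_rpow_le_of_neg hp0 h1 h2
  rwa [show T - r + (r - s) = T - s by ring] at this

theorem integral_rpow_mul_rpow_le {p s T : ℝ} (hp : -1 < p) (hp0 : p ≤ 0) (hsT : s < T) :
    ∫ r in s..T, (T - r) ^ p * (r - s) ^ p
      ≤ 2 ^ (-p) * 2 / (p + 1) * (T - s) ^ (p + 1) * (T - s) ^ p := by
  have i1 := intervalIntegrable_rsub_rpow (s := s) (T := T) hp
  have i2 := intervalIntegrable_sub_rpow (s := s) (T := T) hp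
  have hT : 0 < T - s := sub_pos.2 hsT
  have hp1 : p + 1 ≠ 0 := by linarith
  calc ∫ r in s..T, (T - r) ^ p * (r - s) ^ p
      ≤ ∫ r in s..T, ((T - s) / 2) ^ p * ((T - r) ^ p + (r - s) ^ p) := by
        refine intervalIntegral.integral_mono_on_of_le_Ioo hsT.le
          (intervalIntegrable_rpow_mul_rpow hp hp0 hsT) ((i1.add i2).const_mul _) fun r hr => ?_
        have := rpow_mul_rpow_le_of_neg hp0 (sub_pos.2 hr.2) (sub_pos.2 hr.1)
        rwa [show T - r + (r - s) = T - s by ring] at this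
    _ = 2 ^ (-p) * 2 / (p + 1) * (T - s) ^ (p + 1) * (T - s) ^ p := by
        rw [intervalIntegral.integral_const_mul, intervalIntegral.integral_add i1 i2,
          intervalIntegral.integral_comp_sub_left (fun r => r ^ p) T,
          intervalIntegral.integral_comp_sub_right (fun r => r ^ p) s,
          sub_self, sub_self, integral_rpow (Or.inl hp),
          Real.zero_rpow hp1, Real.div_rpow hT.le (by norm_num), Real.rpow_neg (by norm_num)]
        field_simp
        ring

section Operators

variable {H U : Type*}
  [NormedAddCommGroup H] [InnerProductSpace ℝ H]
  [NormedAddCommGroup U] [InnerProductSpace ℝ U]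

theorem inner_map_comm_of_isSelfAdjoint [CompleteSpace H] {P : H →L[ℝ] H}
    (hP : IsSelfAdjoint P) (x y : H) :
    ⟪P x, y⟫ = ⟪P y, x⟫ := by
  rw [real_inner_comm]
  exact ((ContinuousLinearMap.isSelfAdjoint_iff_isSymmetric.1 hP) y x).symm

theorem inner_map_add_self [CompleteSpace H] {P : H →L[ℝ] H} (hP : IsSelfAdjoint P) (x y : H) :
    ⟪P (x + y), x + y⟫ = ⟪P x, x⟫ + 2 * ⟪P x, y⟫ + ⟪P y, y⟫ := by
  rw [map_add, inner_add_left, inner_add_right, inner_add_right,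
    inner_map_comm_of_isSelfAdjoint hP y x]
  ring

theorem inner_map_add_self_le [CompleteSpace H] {P : H →L[ℝ] H} (hP : IsSelfAdjoint P)
    (hpos : ∀ x : H, 0 ≤ ⟪P x, x⟫) (x y : H) :
    ⟪P (x + y), x + y⟫ ≤ 2 * ⟪P x, x⟫ + 2 * ⟪P y, y⟫ := by
  have h1 := inner_map_add_self hP x y
  have h2 := inner_map_add_self hP x (-y)
  have h3 := hpos (x + -y)
  simp only [map_neg, inner_neg_left, inner_neg_right, neg_neg] at h2 h3
  linarith

theorem inner_map_self_le_of_norm_le {P : H →L[ℝ] H} {M : ℝ} (hM : ‖P‖ ≤ M) (x : H) :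
    ⟪P x, x⟫ ≤ M * ‖x‖ ^ 2 := by
  calc ⟪P x, x⟫ ≤ ‖P x‖ * ‖x‖ := real_inner_le_norm _ _
    _ ≤ (M * ‖x‖) * ‖x‖ := by gcongr; exact P.le_of_opNorm_le hM x
    _ = M * ‖x‖ ^ 2 := by ring

theorem summable_inner_map_of_summable_norm_sq (P : H →L[ℝ] H) {a b : ℕ → H}
    (ha : Summable fun j => ‖a j‖ ^ 2) (hb : Summable fun j => ‖b j‖ ^ 2) :
    Summable fun j => ⟪P (a j), b j⟫ := by
  refine Summable.of_norm_bounded ((ha.add hb).mul_left ‖P‖) fun j => ?_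
  have h : ‖⟪P (a j), b j⟫‖ ≤ ‖P‖ * ‖a j‖ * ‖b j‖ :=
    (norm_inner_le_norm _ _).trans (by gcongr; exact P.le_opNorm _)
  have h2 : ‖a j‖ * ‖b j‖ ≤ ‖a j‖ ^ 2 + ‖b j‖ ^ 2 := by
    nlinarith [sq_nonneg (‖a j‖ - ‖b j‖), sq_nonneg ‖a j‖, sq_nonneg ‖b j‖]
  calc _ ≤ _ := h
    _ = ‖P‖ * (‖a j‖ * ‖b j‖) := by ring
    _ ≤ _ := by gcongr

/-- The quadratic form of `∑ⱼ (Cⱼ z + Dⱼ v)* P (Cⱼ z + Dⱼ v)`, where `a j = Cⱼ z` and the sum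
`∑ⱼ Dⱼ* P Cⱼ z` converges strongly to `w`. -/
theorem hasSum_inner_map_add [CompleteSpace H] [CompleteSpace U] {P : H →L[ℝ] H}
    (hP : IsSelfAdjoint P)
    (hpos : ∀ x : H, 0 ≤ ⟪P x, x⟫) {a : ℕ → H} {D : ℕ → U →L[ℝ] H}
    (ha : Summable fun j => ⟪P (a j), a j⟫) {v w : U} (hD : Summable fun j => ‖D j v‖ ^ 2)
    (hw : Tendsto (fun N => ∑ j ∈ Finset.range N,
      (ContinuousLinearMap.adjoint (D j)) (P (a j))) atTop (nhds w)) :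
    HasSum (fun j => ⟪P (a j + D j v), a j + D j v⟫)
      ((∑' j, ⟪P (a j), a j⟫) + 2 * ⟪w, v⟫ + ∑' j, ⟪P (D j v), D j v⟫) := by
  have hDs := summable_inner_map_of_summable_norm_sq P hD hD
  have hs : Summable fun j => ⟪P (a j + D j v), a j + D j v⟫ :=
    Summable.of_nonneg_of_le (fun j => hpos _) (fun j => inner_map_add_self_le hP hpos _ _)
      ((ha.mul_left 2).add (hDs.mul_left 2))
  have hcross : Summable fun j => ⟪P (a j), D j v⟫ := by
    have := ((hs.sub ha).sub hDs).mul_left (1 / 2)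
    refine this.congr fun j => ?_
    rw [inner_map_add_self hP]; ring
  have hlim : Tendsto (fun N => ∑ j ∈ Finset.range N, ⟪P (a j), D j v⟫) atTop
      (nhds ⟪w, v⟫) := by
    refine (hw.inner tendsto_const_nhds).congr fun N => ?_
    rw [sum_inner]
    exact Finset.sum_congr rfl fun j _ => ContinuousLinearMap.adjoint_inner_left _ _ _
  have heq : HasSum (fun j => ⟪P (a j), D j v⟫) ⟪w, v⟫ := by
    have := tendsto_nhds_unique hcross.hasSum.tendsto_sum_nat hlim
    exact this ▸ hcross.hasSum
  refine ((ha.hasSum.add (heq.mul_left 2)).add hDs.hasSum).congr_fun ?_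
  intro j
  exact inner_map_add_self hP _ _

theorem exists_norm_le_of_continuousOn_Icc {V W : Type*} [NormedAddCommGroup V] [NormedSpace ℝ V]
    [CompleteSpace V] [NormedAddCommGroup W] [NormedSpace ℝ W] {P : ℝ → V →L[ℝ] W} {a b : ℝ}
    (hP : ∀ x, ContinuousOn (fun t => P t x) (Set.Icc a b)) :
    ∃ M : ℝ, 0 ≤ M ∧ ∀ t ∈ Set.Icc a b, ‖P t‖ ≤ M := by
  obtain ⟨M, hM⟩ := banach_steinhaus (g := fun t : Set.Icc a b => P t) fun x => by
    obtain ⟨K, hK⟩ := isCompact_Icc.exists_bound_of_continuousOn (hP x)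
    exact ⟨K, fun t => hK t t.2⟩
  exact ⟨max M 0, le_max_right _ _, fun t ht => (hM ⟨t, ht⟩).trans (le_max_left _ _)⟩

theorem continuousOn_apply_of_norm_le {V W : Type*} [NormedAddCommGroup V] [NormedSpace ℝ V]
    [NormedAddCommGroup W] [NormedSpace ℝ W] {P : ℝ → V →L[ℝ] W} {I : Set ℝ} {M : ℝ}
    (hP : ∀ x, ContinuousOn (fun t => P t x) I) (hM : ∀ t ∈ I, ‖P t‖ ≤ M)
    {y : ℝ → V} (hy : ContinuousOn y I) : ContinuousOn (fun t => P t (y t)) I := by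
  intro s hs
  have h1 : Tendsto (fun t => M * ‖y t - y s‖ + ‖P t (y s) - P s (y s)‖) (nhdsWithin s I)
      (nhds 0) := by
    have h2 := ((hy s hs).tendsto.sub (tendsto_const_nhds (x := y s))).norm.const_mul M
    have h3 := ((hP (y s) s hs).tendsto.sub (tendsto_const_nhds (x := P s (y s)))).norm
    simpa using h2.add h3
  rw [ContinuousWithinAt, tendsto_iff_norm_sub_tendsto_zero]
  refine squeeze_zero' (Eventually.of_forall fun _ => norm_nonneg _) ?_ h1
  filter_upwards [self_mem_nhdsWithin] with t ht
  calc ‖P t (y t) - P s (y s)‖ = ‖P t (y t - y s) + (P t (y s) - P s (y s))‖ := by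
        rw [map_sub]; congr 1; abel
    _ ≤ ‖P t (y t - y s)‖ + ‖P t (y s) - P s (y s)‖ := norm_add_le _ _
    _ ≤ _ := by gcongr; exact (P t).le_of_opNorm_le (hM t ht) _

theorem norm_sq_sub_le_of_inner_eq_tsum {c : ℝ} (hc : 0 < c) {D : ℕ → U →L[ℝ] H}
    (hD : ∀ v : U, (Summable fun j => ‖D j v‖ ^ 2) ∧ (∑' j, ‖D j v‖ ^ 2) ≤ c * ‖v‖ ^ 2)
    {R L L' : U →L[ℝ] U} {P P' : H →L[ℝ] H}
    (hL : ∀ v w : U, ⟪L v, w⟫ = ⟪R v, w⟫ + ∑' j, ⟪P (D j v), D j w⟫)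
    (hL' : ∀ v w : U, ⟪L' v, w⟫ = ⟪R v, w⟫ + ∑' j, ⟪P' (D j v), D j w⟫) (v : U) :
    ‖L v - L' v‖ ^ 2 ≤ c * ∑' j, ‖P (D j v) - P' (D j v)‖ ^ 2 := by
  set u := L v - L' v
  have hsum : Summable fun j => ‖P (D j v) - P' (D j v)‖ ^ 2 := by
    refine Summable.of_nonneg_of_le (fun _ => sq_nonneg _) (fun j => ?_)
      ((hD v).1.mul_left (‖P - P'‖ ^ 2))
    rw [← mul_pow]
    gcongr
    exact (P - P').le_opNorm (D j v)
  have h1 : ‖u‖ ^ 2 = ∑' j, (⟪P (D j v) - P' (D j v), D j u⟫) := by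
    rw [← real_inner_self_eq_norm_sq]
    change ⟪L v - L' v, u⟫ = _
    rw [inner_sub_left, hL, hL', add_sub_add_left_eq_sub, ← Summable.tsum_sub
      (summable_inner_map_of_summable_norm_sq P (hD v).1 (hD u).1)
      (summable_inner_map_of_summable_norm_sq P' (hD v).1 (hD u).1)]
    simp only [inner_sub_left]
  have h2 : ∑' j, (⟪P (D j v) - P' (D j v), D j u⟫)
      ≤ ∑' j, (c / 2 * ‖P (D j v) - P' (D j v)‖ ^ 2 + 1 / (2 * c) * ‖D j u‖ ^ 2) := by
    refine Summable.tsum_le_tsum (fun j => ?_)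
      (summable_inner_map_of_summable_norm_sq (P - P') (hD v).1 (hD u).1)
      ((hsum.mul_left _).add ((hD u).1.mul_left _))
    refine (real_inner_le_norm _ _).trans ?_
    set p := ‖P (D j v) - P' (D j v)‖
    have := sq_nonneg (c * p - ‖D j u‖)
    rw [show c / 2 * p ^ 2 + 1 / (2 * c) * ‖D j u‖ ^ 2
      = (c ^ 2 * p ^ 2 + ‖D j u‖ ^ 2) / (2 * c) by field_simp, le_div_iff₀ (by positivity)]
    nlinarith
  rw [Summable.tsum_add (hsum.mul_left _) ((hD u).1.mul_left _), tsum_mul_left,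
    tsum_mul_left] at h2
  have h3 : 1 / (2 * c) * ∑' j, ‖D j u‖ ^ 2 ≤ 1 / 2 * ‖u‖ ^ 2 := by
    calc _ ≤ 1 / (2 * c) * (c * ‖u‖ ^ 2) := by gcongr; exact (hD u).2
      _ = _ := by field_simp
  linarith

theorem continuousOn_of_inner_eq_tsum {c M : ℝ} (hc : 0 < c) {D : ℕ → U →L[ℝ] H}
    (hD : ∀ v : U, (Summable fun j => ‖D j v‖ ^ 2) ∧ (∑' j, ‖D j v‖ ^ 2) ≤ c * ‖v‖ ^ 2)
    {R : U →L[ℝ] U} {L : ℝ → U →L[ℝ] U} {P : ℝ → H →L[ℝ] H} {I : Set ℝ}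
    (hP : ∀ x, ContinuousOn (fun t => P t x) I) (hM : ∀ t ∈ I, ‖P t‖ ≤ M)
    (hL : ∀ s ∈ I, ∀ v w : U, ⟪L s v, w⟫ = ⟪R v, w⟫ + ∑' j, ⟪P s (D j v), D j w⟫) (v : U) :
    ContinuousOn (fun s => L s v) I := by
  intro s hs
  have hlim : Tendsto (fun t => c * ∑' j, ‖P t (D j v) - P s (D j v)‖ ^ 2) (nhdsWithin s I)
      (nhds (c * ∑' _ : ℕ, (0 : ℝ))) := by
    refine (tendsto_tsum_of_dominated_convergence ((hD v).1.mul_left ((2 * M) ^ 2)) ?_ ?_).const_mul c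
    · intro j
      have := (((hP (D j v) s hs).tendsto.sub (tendsto_const_nhds (x := P s (D j v)))).norm).pow 2
      simpa using this
    · filter_upwards [self_mem_nhdsWithin] with t ht j
      rw [norm_pow, norm_norm, ← mul_pow]
      gcongr
      calc ‖P t (D j v) - P s (D j v)‖ ≤ ‖P t (D j v)‖ + ‖P s (D j v)‖ := norm_sub_le _ _
        _ ≤ M * ‖D j v‖ + M * ‖D j v‖ := by
          gcongr
          · exact (P t).le_of_opNorm_le (hM t ht) _
          · exact (P s).le_of_opNorm_le (hM s hs) _
        _ = 2 * M * ‖D j v‖ := by ring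
  rw [tsum_zero, mul_zero] at hlim
  rw [ContinuousWithinAt, tendsto_iff_norm_sub_tendsto_zero]
  have hsq : Tendsto (fun t => ‖L t v - L s v‖ ^ 2) (nhdsWithin s I) (nhds 0) := by
    refine squeeze_zero' (Eventually.of_forall fun _ => sq_nonneg _) ?_ hlim
    filter_upwards [self_mem_nhdsWithin] with t ht
    exact norm_sq_sub_le_of_inner_eq_tsum hc hD (hL t ht) (hL s hs) v
  have := hsq.sqrt
  simpa [Real.sqrt_sq (norm_nonneg _)] using this

theorem mul_norm_le_norm_of_coercive {L : U →L[ℝ] U} {δ : ℝ}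
    (hL : ∀ v, δ * ‖v‖ ^ 2 ≤ ⟪L v, v⟫) (v : U) : δ * ‖v‖ ≤ ‖L v‖ := by
  rcases eq_or_ne v 0 with rfl | hv
  · simp
  · have h := (hL v).trans (real_inner_le_norm _ _)
    have hv' : 0 < ‖v‖ := norm_pos_iff.2 hv
    refine le_of_mul_le_mul_right ?_ hv'
    linarith [h, sq ‖v‖]

theorem surjective_of_coercive [CompleteSpace U] {L : U →L[ℝ] U} {δ : ℝ} (hδ : 0 < δ)
    (hL : ∀ v, δ * ‖v‖ ^ 2 ≤ ⟪L v, v⟫) : Function.Surjective L := by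
  let b : U →L[ℝ] U →L[ℝ] ℝ := (innerSL ℝ).comp L
  have hb : IsCoercive b := ⟨δ, hδ, fun u => by
    have := hL u
    rw [sq, ← mul_assoc] at this
    simpa [b] using this⟩
  intro w
  refine ⟨hb.continuousLinearEquivOfBilin.symm w, ?_⟩
  refine ext_inner_right ℝ fun u => ?_
  have := hb.continuousLinearEquivOfBilin_apply (hb.continuousLinearEquivOfBilin.symm w) u
  simpa [b] using this.symm

theorem continuousOn_of_coercive_map_eq {L : ℝ → U →L[ℝ] U} {δ : ℝ} (hδ : 0 < δ) {I : Set ℝ}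
    (hcoer : ∀ s ∈ I, ∀ v, δ * ‖v‖ ^ 2 ≤ ⟪L s v, v⟫)
    (hL : ∀ v, ContinuousOn (fun s => L s v) I) {a w : ℝ → U} (hw : ContinuousOn w I)
    (ha : ∀ s ∈ I, L s (a s) = w s) : ContinuousOn a I := by
  intro s hs
  have h1 : Tendsto (fun t => δ⁻¹ * (‖w t - w s‖ + ‖L t (a s) - L s (a s)‖)) (nhdsWithin s I)
      (nhds 0) := by
    have h2 := ((hw s hs).tendsto.sub (tendsto_const_nhds (x := w s))).norm
    have h3 := ((hL (a s) s hs).tendsto.sub (tendsto_const_nhds (x := L s (a s)))).norm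
    simpa using (h2.add h3).const_mul δ⁻¹
  rw [ContinuousWithinAt, tendsto_iff_norm_sub_tendsto_zero]
  refine squeeze_zero' (Eventually.of_forall fun _ => norm_nonneg _) ?_ h1
  filter_upwards [self_mem_nhdsWithin] with t ht
  rw [← div_eq_inv_mul, le_div_iff₀ hδ, mul_comm]
  calc δ * ‖a t - a s‖ ≤ ‖L t (a t - a s)‖ := mul_norm_le_norm_of_coercive (hcoer t ht) _
    _ = ‖(w t - w s) - (L t (a s) - L s (a s))‖ := by
      rw [map_sub, ha t ht, ← ha s hs]; congr 1; abel
    _ ≤ _ := norm_sub_le _ _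

end Operators

theorem one_le_rpow_neg_mul_rpow {p a T : ℝ} (hp : p ≤ 0) (ha : 0 < a) (haT : a ≤ T) :
    1 ≤ T ^ (-p) * a ^ p := by
  have hT : 0 < T := ha.trans_le haT
  calc (1 : ℝ) = T ^ (-p) * T ^ p := by rw [← Real.rpow_add hT]; simp
    _ ≤ T ^ (-p) * a ^ p :=
        mul_le_mul_of_nonneg_left (Real.rpow_le_rpow_of_nonpos ha haT hp) (by positivity)

section Riccati

variable {H U : Type*}
  [NormedAddCommGroup H] [InnerProductSpace ℝ H] [CompleteSpace H]
  [NormedAddCommGroup U] [InnerProductSpace ℝ U] [CompleteSpace U]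

theorem riccati_gain_le {P : H →L[ℝ] H} (hP : IsSelfAdjoint P) (hpos : ∀ x : H, 0 ≤ ⟪P x, x⟫)
    {M δ : ℝ} (hδ : 0 < δ) (hM : ‖P‖ ≤ M) {B : U →L[ℝ] H} {a : ℕ → H} {D : ℕ → U →L[ℝ] H}
    {R L : U →L[ℝ] U} (ha : Summable fun j => ⟪P (a j), a j⟫) {z : H} {l : U}
    (hD : Summable fun j => ‖D j l‖ ^ 2) (hR : ∀ v : U, δ * ‖v‖ ^ 2 ≤ ⟪R v, v⟫)
    (hL : ∀ v w : U, ⟪L v, w⟫ = ⟪R v, w⟫ + ∑' j, ⟪P (D j v), D j w⟫)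
    (hw : Tendsto (fun N => ∑ j ∈ Finset.range N,
      (ContinuousLinearMap.adjoint (D j)) (P (a j))) atTop
      (nhds (-(L l) - (ContinuousLinearMap.adjoint B) (P z)))) :
    ⟪L l, l⟫ ≤ (∑' j, ⟪P (a j), a j⟫) + M ^ 2 * ‖B‖ ^ 2 / δ * ‖z‖ ^ 2 := by
  have h1 := hasSum_inner_map_add hP hpos ha hD hw
  have h2 := h1.nonneg fun j => hpos _
  rw [inner_sub_left, inner_neg_left, ContinuousLinearMap.adjoint_inner_left] at h2
  have h3 := hL l l
  have h4 := hR l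
  have h5 : -⟪P z, B l⟫ ≤ M * ‖B‖ * ‖z‖ * ‖l‖ := by
    calc -⟪P z, B l⟫ ≤ |⟪P z, B l⟫| := neg_le_abs _
      _ ≤ ‖P z‖ * ‖B l‖ := abs_real_inner_le_norm _ _
      _ ≤ (M * ‖z‖) * (‖B‖ * ‖l‖) := by
        gcongr
        · exact mul_nonneg ((norm_nonneg _).trans hM) (norm_nonneg _)
        · exact P.le_of_opNorm_le hM z
        · exact B.le_opNorm l
      _ = _ := by ring
  have h6 : 2 * (M * ‖B‖ * ‖z‖ * ‖l‖) ≤ δ * ‖l‖ ^ 2 + M ^ 2 * ‖B‖ ^ 2 / δ * ‖z‖ ^ 2 := by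
    have h7 := sq_nonneg (δ * ‖l‖ - M * ‖B‖ * ‖z‖)
    rw [show δ * ‖l‖ ^ 2 + M ^ 2 * ‖B‖ ^ 2 / δ * ‖z‖ ^ 2
      = ((δ * ‖l‖) ^ 2 + (M * ‖B‖ * ‖z‖) ^ 2) / δ by field_simp, le_div_iff₀ hδ]
    nlinarith
  linarith

/-- The quadratic information carried by a mild solution `P` on `[0,T]`: `G s` is the quadratic
form of the right-hand side of the Riccati equation at time `s`, which is minimised over all
controls by the feedback `lam s`. -/
structure IsRiccatiEnergy (T α M K : ℝ) (S : ℝ → H →L[ℝ] H)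
    (B : U →L[ℝ] H) (C : ℕ → H →L[ℝ] H) (D : ℕ → U →L[ℝ] H)
    (Q : H →L[ℝ] H) (R : U →L[ℝ] U) (P : ℝ → H →L[ℝ] H)
    (lam : ℝ → H →L[ℝ] U) (G : ℝ → H → ℝ) : Prop where
  selfAdjoint : ∀ t ∈ Set.Icc (0 : ℝ) T, IsSelfAdjoint (P t)
  nonneg : ∀ t ∈ Set.Icc (0 : ℝ) T, ∀ x, 0 ≤ ⟪P t x, x⟫
  le : ∀ t ∈ Set.Icc (0 : ℝ) T, ∀ x, ⟪P t x, x⟫ ≤ M * ‖x‖ ^ 2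
  summable : ∀ s ∈ Set.Ico (0 : ℝ) T, ∀ x, Summable fun j => ⟪P s (C j x), C j x⟫
  tsum_le : ∀ s ∈ Set.Ico (0 : ℝ) T, ∀ x,
    (∑' j, ⟪P s (C j x), C j x⟫) ≤ K * (T - s) ^ (-2 * α) * ‖x‖ ^ 2
  gain_le : ∀ s ∈ Set.Ico (0 : ℝ) T, ∀ x, ‖lam s x‖ ^ 2 ≤ K * (T - s) ^ (-2 * α) * ‖x‖ ^ 2
  summable_control : ∀ s ∈ Set.Ico (0 : ℝ) T, ∀ z v,
    Summable fun j => ⟪P s (C j z + D j v), C j z + D j v⟫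
  le_control : ∀ s ∈ Set.Ico (0 : ℝ) T, ∀ z v,
    G s z ≤ (∑' j, ⟪P s (C j z + D j v), C j z + D j v⟫) + ⟪Q z, z⟫ + ⟪R v, v⟫
      + 2 * ⟪P s z, B v⟫
  eq_feedback : ∀ s ∈ Set.Ico (0 : ℝ) T, ∀ z,
    G s z = (∑' j, ⟪P s (C j z + D j (lam s z)), C j z + D j (lam s z)⟫) + ⟪Q z, z⟫
      + ⟪R (lam s z), lam s z⟫ + 2 * ⟪P s z, B (lam s z)⟫
  integrable : ∀ t ∈ Set.Icc (0 : ℝ) T, ∀ x,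
    IntervalIntegrable (fun s => G s (S (s - t) x)) volume t T
  energy : ∀ t ∈ Set.Icc (0 : ℝ) T, ∀ s ∈ Set.Icc t T, ∀ x,
    ⟪P s (S (s - t) x), S (s - t) x⟫ = ∫ r in s..T, G r (S (r - t) x)

theorem IsRiccatiMildSolutionTI.exists_isRiccatiEnergy
    {α c δ T : ℝ} (hα0 : 0 < α) (hα : α < 1 / 2) (hc : 0 < c) (hδ : 0 < δ) (hT : 0 < T)
    {S : ℝ → H →L[ℝ] H}
    (hSadd : ∀ s t : ℝ, 0 ≤ s → 0 ≤ t → S (s + t) = (S s).comp (S t))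
    (hScont : ∀ x : H, ContinuousOn (fun t => S t x) (Set.Ici (0 : ℝ)))
    {B : U →L[ℝ] H} {C : ℕ → H →L[ℝ] H} {D : ℕ → U →L[ℝ] H}
    {Q : H →L[ℝ] H} {R : U →L[ℝ] U} (hRsa : IsSelfAdjoint R)
    (hRcoer : ∀ v : U, δ * ‖v‖ ^ 2 ≤ ⟪R v, v⟫)
    (hD : ∀ v : U, (Summable fun j => ‖D j v‖ ^ 2) ∧ (∑' j, ‖D j v‖ ^ 2) ≤ c * ‖v‖ ^ 2)
    {P : ℝ → H →L[ℝ] H} (hP : IsRiccatiMildSolutionTI T S B C D Q R P)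
    (hPK : RiccatiSingularBoundTI T α C P) :
    ∃ (M K : ℝ) (lam : ℝ → H →L[ℝ] U) (G : ℝ → H → ℝ), 0 ≤ M ∧ 0 ≤ K ∧
      IsRiccatiEnergy T α M K S B C D Q R P lam G := by
  obtain ⟨hpos, hcont, hsum, L, lam, hL, hlim, hmild⟩ := hP
  obtain ⟨K₀, hK₀⟩ := hPK
  have hp1 : -1 < -2 * α := by linarith
  have hp0 : -2 * α ≤ 0 := by linarith
  obtain ⟨M, hM0, hM⟩ := exists_norm_le_of_continuousOn_Icc hcont
  have hIco : ∀ {s}, s ∈ Set.Ico (0 : ℝ) T → s ∈ Set.Icc (0 : ℝ) T := fun h => ⟨h.1, h.2.le⟩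
  have hLcoer : ∀ s ∈ Set.Ico (0 : ℝ) T, ∀ v, δ * ‖v‖ ^ 2 ≤ ⟪L s v, v⟫ := by
    intro s hs v
    rw [hL s hs]
    have : 0 ≤ ∑' j, ⟪P s (D j v), D j v⟫ := tsum_nonneg fun j => (hpos s (hIco hs)).2 _
    linarith [hRcoer v]
  have hLsymm : ∀ s ∈ Set.Ico (0 : ℝ) T, ∀ v w, ⟪L s v, w⟫ = ⟪L s w, v⟫ := by
    intro s hs v w
    rw [hL s hs, hL s hs, inner_map_comm_of_isSelfAdjoint hRsa]
    simp only [inner_map_comm_of_isSelfAdjoint (hpos s (hIco hs)).1 (D _ v)]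
  set E : ℝ := M ^ 2 * ‖B‖ ^ 2 / δ with hE
  have hE0 : 0 ≤ E := by positivity
  have hgain : ∀ s ∈ Set.Ico (0 : ℝ) T, ∀ x, ⟪L s (lam s x), lam s x⟫
      ≤ (∑' j, ⟪P s (C j x), C j x⟫) + E * ‖x‖ ^ 2 := fun s hs x =>
    riccati_gain_le (hpos s (hIco hs)).1 (hpos s (hIco hs)).2 hδ (hM s (hIco hs)) (hsum s hs x)
      (hD _).1 hRcoer (hL s hs) (hlim s hs x)
  set K₁ : ℝ := max K₀ 0
  have hK₁0 : 0 ≤ K₁ := le_max_right _ _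
  have hrpow : ∀ s ∈ Set.Ico (0 : ℝ) T, 0 ≤ (T - s) ^ (-2 * α) := fun s hs =>
    Real.rpow_nonneg (sub_nonneg.2 hs.2.le) _
  have hK₁ : ∀ s ∈ Set.Ico (0 : ℝ) T, ∀ x,
      (∑' j, ⟪P s (C j x), C j x⟫) ≤ K₁ * (T - s) ^ (-2 * α) * ‖x‖ ^ 2 := fun s hs x =>
    (hK₀ s hs x).trans (by have := hrpow s hs; gcongr; exact le_max_left _ _)
  set K₂ : ℝ := K₁ + E * T ^ (-(-2 * α)) with hK₂
  have hK₂0 : 0 ≤ K₂ := by positivity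
  have hgain₂ : ∀ s ∈ Set.Ico (0 : ℝ) T, ∀ x, ⟪L s (lam s x), lam s x⟫
      ≤ K₂ * (T - s) ^ (-2 * α) * ‖x‖ ^ 2 := by
    intro s hs x
    have h1 := hgain s hs x
    have h2 := hK₁ s hs x
    have h3 := one_le_rpow_neg_mul_rpow hp0 (sub_pos.2 hs.2) (sub_le_self T hs.1)
    have h4 : E * ‖x‖ ^ 2 * 1 ≤ E * ‖x‖ ^ 2 * (T ^ (-(-2 * α)) * (T - s) ^ (-2 * α)) := by gcongr
    rw [hK₂]
    linarith
  set G : ℝ → H → ℝ := fun s z => (∑' j, ⟪P s (C j z), C j z⟫) + ⟪Q z, z⟫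
    - ⟪L s (lam s z), lam s z⟫ with hG
  have hHS : ∀ s ∈ Set.Ico (0 : ℝ) T, ∀ z v,
      HasSum (fun j => ⟪P s (C j z + D j v), C j z + D j v⟫)
        ((∑' j, ⟪P s (C j z), C j z⟫) - 2 * ⟪L s (lam s z), v⟫ - 2 * ⟪P s z, B v⟫
          + (⟪L s v, v⟫ - ⟪R v, v⟫)) := by
    intro s hs z v
    have h := hasSum_inner_map_add (hpos s (hIco hs)).1 (hpos s (hIco hs)).2 (hsum s hs z)
      (hD v).1 (hlim s hs z)
    rw [inner_sub_left, inner_neg_left, ContinuousLinearMap.adjoint_inner_left] at h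
    convert h using 1
    rw [hL s hs v v]
    ring
  refine ⟨M, K₁ + K₂ / δ, lam, G, hM0, by positivity, ⟨fun t ht => (hpos t ht).1,
    fun t ht => (hpos t ht).2, fun t ht => inner_map_self_le_of_norm_le (hM t ht), hsum, ?_, ?_,
    fun s hs z v => (hHS s hs z v).summable, ?_, ?_, ?_, ?_⟩⟩
  · intro s hs x
    have := hrpow s hs
    refine (hK₁ s hs x).trans ?_
    gcongr
    exact le_add_of_nonneg_right (by positivity)
  · intro s hs x
    have h0 := hrpow s hs
    have h1 := (hLcoer s hs (lam s x)).trans (hgain₂ s hs x)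
    calc ‖lam s x‖ ^ 2 ≤ K₂ / δ * (T - s) ^ (-2 * α) * ‖x‖ ^ 2 := by
          rw [show K₂ / δ * (T - s) ^ (-2 * α) * ‖x‖ ^ 2
            = (K₂ * (T - s) ^ (-2 * α) * ‖x‖ ^ 2) / δ by ring, le_div_iff₀ hδ]
          linarith
      _ ≤ _ := by gcongr; exact le_add_of_nonneg_left hK₁0
  · intro s hs z v
    rw [(hHS s hs z v).tsum_eq]
    have h1 := hLcoer s hs (v - lam s z)
    have h2 : 0 ≤ δ * ‖v - lam s z‖ ^ 2 := by positivity
    rw [map_sub, inner_sub_left, inner_sub_right, inner_sub_right,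
      hLsymm s hs v (lam s z)] at h1
    simp only [hG]
    linarith
  · intro s hs z
    rw [(hHS s hs z _).tsum_eq]
    simp only [hG]
    ring
  · intro t ht x
    obtain ⟨N, hN0, hN⟩ := exists_norm_le_of_continuousOn_Icc (P := S) (a := 0) (b := T)
      fun x => (hScont x).mono Set.Icc_subset_Ici_self
    rw [intervalIntegrable_iff_integrableOn_Ioo_of_le ht.2]
    set I := Set.Ioo t T
    have hI : ∀ {s}, s ∈ I → s ∈ Set.Ico (0 : ℝ) T := fun h => ⟨ht.1.trans h.1.le, h.2⟩
    have hz : ContinuousOn (fun s => S (s - t) x) I :=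
      (hScont x).comp (by fun_prop) fun s hs => sub_nonneg.2 hs.1.le
    have hPI : ∀ y, ContinuousOn (fun t => P t y) I := fun y =>
      (hcont y).mono fun s hs => hIco (hI hs)
    have hMI : ∀ s ∈ I, ‖P s‖ ≤ M := fun s hs => hM s (hIco (hI hs))
    have hLI : ∀ v, ContinuousOn (fun s => L s v) I := fun v =>
      continuousOn_of_inner_eq_tsum hc hD hPI hMI (fun s hs => hL s (hI hs)) v
    have hzN : ∀ s ∈ I, ‖S (s - t) x‖ ≤ N * ‖x‖ := fun s hs =>
      (S (s - t)).le_of_opNorm_le (hN _ ⟨sub_nonneg.2 hs.1.le, by linarith [hs.2, ht.1]⟩) x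
    set w : ℕ → ℝ → U := fun n s => (∑ j ∈ Finset.range n,
      (ContinuousLinearMap.adjoint (D j)) (P s (C j (S (s - t) x))))
        + (ContinuousLinearMap.adjoint B) (P s (S (s - t) x)) with hw
    have hwc : ∀ n, ContinuousOn (w n) I := fun n => by
      refine (continuousOn_finsetSum _ fun j _ => ?_).add ?_
      · exact (ContinuousLinearMap.continuous _).comp_continuousOn
          (continuousOn_apply_of_norm_le hPI hMI ((C j).continuous.comp_continuousOn hz))
      · exact (ContinuousLinearMap.continuous _).comp_continuousOn
          (continuousOn_apply_of_norm_le hPI hMI hz)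
    have hwlim : ∀ s ∈ I, Tendsto (fun n => w n s) atTop
        (nhds (-(L s (lam s (S (s - t) x))))) := fun s hs => by
      have := (hlim s (hI hs) (S (s - t) x)).add_const
        ((ContinuousLinearMap.adjoint B) (P s (S (s - t) x)))
      simpa [hw] using this
    have hex : ∀ n s, ∃ a, s ∈ I → L s a = w n s := fun n s => by
      by_cases hs : s ∈ I
      · obtain ⟨a, ha⟩ := surjective_of_coercive hδ (hLcoer s (hI hs)) (w n s)
        exact ⟨a, fun _ => ha⟩
      · exact ⟨0, fun h => absurd h hs⟩
    choose a ha using hex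
    have hac : ∀ n, ContinuousOn (a n) I := fun n =>
      continuousOn_of_coercive_map_eq hδ (fun s hs => hLcoer s (hI hs)) hLI (hwc n) (ha n)
    have halim : ∀ s ∈ I, Tendsto (fun n => a n s) atTop
        (nhds (-(lam s (S (s - t) x)))) := fun s hs => by
      rw [tendsto_iff_norm_sub_tendsto_zero]
      have h1 := ((tendsto_iff_norm_sub_tendsto_zero.1 (hwlim s hs)).const_mul δ⁻¹)
      rw [mul_zero] at h1
      refine squeeze_zero (fun _ => norm_nonneg _) (fun n => ?_) h1
      rw [← div_eq_inv_mul, le_div_iff₀ hδ, mul_comm, ← ha n s hs, ← map_neg (L s), ← map_sub]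
      exact mul_norm_le_norm_of_coercive (hLcoer s (hI hs)) _
    have hmeasL : AEStronglyMeasurable (fun s => ⟪L s (lam s (S (s - t) x)), lam s (S (s - t) x)⟫)
        (volume.restrict I) := by
      refine aestronglyMeasurable_of_tendsto_ae atTop (f := fun n s => ⟪w n s, a n s⟫)
        (fun n => ((hwc n).inner (𝕜 := ℝ) (hac n)).aestronglyMeasurable measurableSet_Ioo) ?_
      filter_upwards [ae_restrict_mem measurableSet_Ioo] with s hs
      simpa using (hwlim s hs).inner (𝕜 := ℝ) (halim s hs)
    have hmeasC : AEStronglyMeasurable (fun s => ∑' j, ⟪P s (C j (S (s - t) x)),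
        C j (S (s - t) x)⟫) (volume.restrict I) := by
      refine aestronglyMeasurable_of_tendsto_ae atTop (f := fun n s => ∑ j ∈ Finset.range n,
        ⟪P s (C j (S (s - t) x)), C j (S (s - t) x)⟫) (fun n => ?_) ?_
      · refine ContinuousOn.aestronglyMeasurable (continuousOn_finsetSum _ fun j _ => ?_)
          measurableSet_Ioo
        have hCz := (C j).continuous.comp_continuousOn hz
        exact (continuousOn_apply_of_norm_le hPI hMI hCz).inner (𝕜 := ℝ) hCz
      · filter_upwards [ae_restrict_mem measurableSet_Ioo] with s hs
        exact (hsum s (hI hs) _).hasSum.tendsto_sum_nat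
    have hmeasQ : AEStronglyMeasurable (fun s => ⟪Q (S (s - t) x), S (s - t) x⟫)
        (volume.restrict I) :=
      ((Q.continuous.comp_continuousOn hz).inner (𝕜 := ℝ) hz).aestronglyMeasurable
        measurableSet_Ioo
    have hdom : IntegrableOn (fun s => ((K₁ + K₂) * (T - s) ^ (-2 * α) + ‖Q‖) * (N * ‖x‖) ^ 2)
        I := by
      rw [← intervalIntegrable_iff_integrableOn_Ioo_of_le ht.2]
      exact (((intervalIntegrable_rsub_rpow hp1).const_mul _).add
        intervalIntegrable_const).mul_const _
    refine Integrable.mono' hdom ((hmeasC.add hmeasQ).sub hmeasL) ?_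
    filter_upwards [ae_restrict_mem measurableSet_Ioo] with s hs
    have hs' := hI hs
    have h0 := hrpow s hs'
    set z := S (s - t) x
    have e1 := hK₁ s hs' z
    have e2 := hgain₂ s hs' z
    have e3 : |⟪Q z, z⟫| ≤ ‖Q‖ * ‖z‖ ^ 2 := by
      refine (abs_real_inner_le_norm _ _).trans ?_
      rw [sq, ← mul_assoc]
      gcongr
      exact Q.le_opNorm z
    have e4 : 0 ≤ ∑' j, ⟪P s (C j z), C j z⟫ := tsum_nonneg fun j => (hpos s (hIco hs')).2 _
    have e5 : 0 ≤ ⟪L s (lam s z), lam s z⟫ :=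
      le_trans (by positivity) (hLcoer s hs' (lam s z))
    have e6 : ‖G s z‖ ≤ ((K₁ + K₂) * (T - s) ^ (-2 * α) + ‖Q‖) * ‖z‖ ^ 2 := by
      have := abs_le.1 e3
      rw [Real.norm_eq_abs, abs_le]
      simp only [hG]
      constructor <;> nlinarith [e1, e2, e4, e5, this.1, this.2]
    refine e6.trans ?_
    gcongr
    exact hzN s hs
  · intro t ht s hs x
    rw [hmild s ⟨ht.1.trans hs.1, hs.2⟩]
    refine intervalIntegral.integral_congr fun r hr => ?_
    rw [Set.uIcc_of_le hs.2] at hr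
    have : S (r - t) = (S (r - s)).comp (S (s - t)) := by
      rw [← hSadd _ _ (sub_nonneg.2 hr.1) (sub_nonneg.2 hs.1)]
      congr 1; ring
    simp only [hG, this, ContinuousLinearMap.comp_apply]

end Riccati

section Comparison

variable {H U : Type*}
  [NormedAddCommGroup H] [InnerProductSpace ℝ H]
  [NormedAddCommGroup U] [InnerProductSpace ℝ U]

/-- A lower bound for the jump terms `a * q s (E s z) + ∑ⱼ q s (F j s z)` on a backward interval
of length `τ` propagates to a lower bound for `q` itself. -/
theorem neg_integral_le_of_jump_lower_bound {S : ℝ → H →L[ℝ] H} {q : ℝ → H → ℝ}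
    {E : ℝ → H → H} {F : ℕ → ℝ → H → H} {a p κ t T T₁ : ℝ} (hp : -1 < p) (ha : 0 ≤ a)
    (hκ : 0 ≤ κ) (ht : t < T) (hT : T ≤ T₁) (hS0 : S 0 = ContinuousLinearMap.id ℝ H)
    (hScont : ∀ x : H, ContinuousOn (fun t => S t x) (Set.Ici (0 : ℝ)))
    (hq : ∀ x, ∃ g : ℝ → ℝ, IntervalIntegrable g volume t T₁ ∧
      (∀ s ∈ Set.Icc t T₁, q s (S (s - t) x) = q T₁ (S (T₁ - t) x) + ∫ r in s..T₁, g r) ∧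
      ∀ s ∈ Set.Ico t T₁, -(a * q s (S (s - t) x)) + (a * q s (E s (S (s - t) x))
        + ∑' j, q s (F j s (S (s - t) x))) ≤ g s)
    (hqT : ∀ x, 0 ≤ q T x)
    (hlow : ∀ s ∈ Set.Ico t T, ∀ z,
      -(κ * (T - s) ^ p * ‖z‖ ^ 2) ≤ a * q s (E s z) + ∑' j, q s (F j s z)) (x : H) :
    IntervalIntegrable (fun s => κ * (T - s) ^ p * ‖S (s - t) x‖ ^ 2) volume t T ∧
      -∫ s in t..T, κ * (T - s) ^ p * ‖S (s - t) x‖ ^ 2 ≤ q t x := by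
  obtain ⟨g, hg, hgeq, hgle⟩ := hq x
  have hsub : ∀ {u v}, t ≤ u → u ≤ v → v ≤ T₁ → IntervalIntegrable g volume u v :=
    fun h1 h2 h3 => hg.mono_set (by
      rw [Set.uIcc_of_le (h1.trans (h2.trans h3)), Set.uIcc_of_le h2]
      exact Set.Icc_subset_Icc h1 h3)
  have hY : IntervalIntegrable (fun s => κ * (T - s) ^ p * ‖S (s - t) x‖ ^ 2) volume t T := by
    refine ((intervalIntegrable_rsub_rpow hp).const_mul κ).mul_continuousOn ?_
    rw [Set.uIcc_of_le ht.le]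
    exact ((hScont x).comp (by fun_prop) fun s hs => sub_nonneg.2 hs.1).norm.pow 2
  refine ⟨hY, ?_⟩
  have h := neg_integral_le_of_backward_inequality (f := fun s => q s (S (s - t) x)) ht.le ha
    (hsub le_rfl ht.le hT) hY (fun s hs => by
      have := Real.rpow_nonneg (sub_nonneg.2 hs.2.le) p
      positivity)
    (fun s hs => by
      have h1 := hgeq s ⟨hs.1, hs.2.trans hT⟩
      have h2 := hgeq T ⟨ht.le, hT⟩
      have h3 := intervalIntegral.integral_add_adjacent_intervals (hsub hs.1 hs.2 hT)
        (hsub ht.le hT le_rfl)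
      linarith)
    (hqT _) (fun s hs => by
      have h1 := hgle s ⟨hs.1, hs.2.trans_le hT⟩
      have h2 := hlow s hs (S (s - t) x)
      linarith)
  simpa [hS0] using h

/-- Positivity for a backward evolution with jump terms that are regularised by the semigroup. -/
theorem nonneg_of_backward_smoothing {S : ℝ → H →L[ℝ] H} {q : ℝ → H → ℝ}
    {E : ℝ → H → H} {F : ℕ → ℝ → H → H} {a p κ₀ k T₁ : ℝ} (hp : -1 < p) (hp0 : p ≤ 0)
    (ha : 0 ≤ a) (hκ₀ : 0 ≤ κ₀) (hk : 0 ≤ k) (hS0 : S 0 = ContinuousLinearMap.id ℝ H)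
    (hScont : ∀ x : H, ContinuousOn (fun t => S t x) (Set.Ici (0 : ℝ)))
    (hq : ∀ t ∈ Set.Ico 0 T₁, ∀ x, ∃ g : ℝ → ℝ, IntervalIntegrable g volume t T₁ ∧
      (∀ s ∈ Set.Icc t T₁, q s (S (s - t) x) = q T₁ (S (T₁ - t) x) + ∫ r in s..T₁, g r) ∧
      ∀ s ∈ Set.Ico t T₁, -(a * q s (S (s - t) x)) + (a * q s (E s (S (s - t) x))
        + ∑' j, q s (F j s (S (s - t) x))) ≤ g s)
    (hqT : ∀ x, 0 ≤ q T₁ x)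
    (hsum : ∀ s ∈ Set.Ico 0 T₁, ∀ z, Summable fun j => q s (F j s z))
    (hlow : ∀ s ∈ Set.Ico 0 T₁, ∀ z,
      -(κ₀ * (T₁ - s) ^ p * ‖z‖ ^ 2) ≤ a * q s (E s z) + ∑' j, q s (F j s z))
    (hsmooth : ∀ s r, 0 ≤ s → s < r → r ≤ T₁ → ∀ z n,
      a * ‖S (r - s) (E s z)‖ ^ 2 + ∑ j ∈ Finset.range n, ‖S (r - s) (F j s z)‖ ^ 2
        ≤ k * (r - s) ^ p * ‖z‖ ^ 2) :
    ∀ t ∈ Set.Icc 0 T₁, ∀ x, 0 ≤ q t x := by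
  have hp1 : 0 < p + 1 := by linarith
  set A : ℝ := 2 ^ (-p) * 2 / (p + 1) with hA
  have hA0 : 0 ≤ A := by positivity
  set τ : ℝ := (1 / (2 * (k * A + 1))) ^ (p + 1)⁻¹ with hτ
  have hτ0 : 0 < τ := by positivity
  have hkτ : k * A * τ ^ (p + 1) ≤ 1 / 2 := by
    rw [hτ, Real.rpow_inv_rpow (by positivity) hp1.ne', mul_one_div,
      div_le_iff₀ (by positivity)]
    linarith
  have hhalf : ∀ T, T ≤ T₁ → (∀ x, 0 ≤ q T x) → ∀ κ, 0 ≤ κ →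
      (∀ s, 0 ≤ s → T - τ ≤ s → s < T → ∀ z,
        -(κ * (T - s) ^ p * ‖z‖ ^ 2) ≤ a * q s (E s z) + ∑' j, q s (F j s z)) →
      ∀ s, 0 ≤ s → T - τ ≤ s → s < T → ∀ z,
        -(κ / 2 * (T - s) ^ p * ‖z‖ ^ 2) ≤ a * q s (E s z) + ∑' j, q s (F j s z) := by
    intro T hT hqT' κ hκ hyp s hs0 hsτ hsT z
    have hs₁ : s ∈ Set.Ico 0 T₁ := ⟨hs0, hsT.trans_le hT⟩
    have hTs : 0 < T - s := sub_pos.2 hsT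
    have hlb := neg_integral_le_of_jump_lower_bound hp ha hκ hsT hT hS0 hScont (hq s hs₁) hqT'
      (fun r hr => hyp r (hs0.trans hr.1) (hsτ.trans hr.1) hr.2)
    have hpart : ∀ n, -(κ / 2 * (T - s) ^ p * ‖z‖ ^ 2)
        ≤ a * q s (E s z) + ∑ j ∈ Finset.range n, q s (F j s z) := by
      intro n
      have hiE := (hlb (E s z)).1.const_mul a
      have hiF : IntervalIntegrable (fun r => ∑ j ∈ Finset.range n,
          κ * (T - r) ^ p * ‖S (r - s) (F j s z)‖ ^ 2) volume s T := by
        have := IntervalIntegrable.sum (Finset.range n) fun j _ => (hlb (F j s z)).1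
        simpa [Finset.sum_fn] using this
      have hsplit : ∫ r in s..T, (a * (κ * (T - r) ^ p * ‖S (r - s) (E s z)‖ ^ 2)
            + ∑ j ∈ Finset.range n, κ * (T - r) ^ p * ‖S (r - s) (F j s z)‖ ^ 2)
          ≤ ∫ r in s..T, κ * k * ‖z‖ ^ 2 * ((T - r) ^ p * (r - s) ^ p) := by
        refine intervalIntegral.integral_mono_on_of_le_Ioo hsT.le (hiE.add hiF)
          ((intervalIntegrable_rpow_mul_rpow hp hp0 hsT).const_mul _) fun r hr => ?_
        have h1 := Real.rpow_nonneg (sub_nonneg.2 hr.2.le) p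
        calc _ = κ * (T - r) ^ p * (a * ‖S (r - s) (E s z)‖ ^ 2
              + ∑ j ∈ Finset.range n, ‖S (r - s) (F j s z)‖ ^ 2) := by
              rw [← Finset.mul_sum]; ring
          _ ≤ κ * (T - r) ^ p * (k * (r - s) ^ p * ‖z‖ ^ 2) := by
              gcongr
              exact hsmooth s r hs0 hr.1 (hr.2.le.trans hT) z n
          _ = _ := by ring
      rw [intervalIntegral.integral_const_mul, intervalIntegral.integral_add hiE hiF,
        intervalIntegral.integral_const_mul,
        intervalIntegral.integral_finsetSum fun j _ => (hlb (F j s z)).1] at hsplit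
      have h2 := integral_rpow_mul_rpow_le hp hp0 hsT
      have h3 : κ * k * ‖z‖ ^ 2 * (∫ r in s..T, (T - r) ^ p * (r - s) ^ p)
          ≤ κ / 2 * (T - s) ^ p * ‖z‖ ^ 2 := by
        have hpow : (T - s) ^ (p + 1) ≤ τ ^ (p + 1) :=
          Real.rpow_le_rpow hTs.le (by linarith) hp1.le
        calc _ ≤ κ * k * ‖z‖ ^ 2 * (A * (T - s) ^ (p + 1) * (T - s) ^ p) := by gcongr
          _ ≤ κ * k * ‖z‖ ^ 2 * (A * τ ^ (p + 1) * (T - s) ^ p) := by gcongr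
          _ = (k * A * τ ^ (p + 1)) * (κ * (T - s) ^ p * ‖z‖ ^ 2) := by ring
          _ ≤ 1 / 2 * (κ * (T - s) ^ p * ‖z‖ ^ 2) := by gcongr
          _ = _ := by ring
      have h4 := mul_le_mul_of_nonneg_left (hlb (E s z)).2 ha
      have h5 := Finset.sum_le_sum fun j (_ : j ∈ Finset.range n) => (hlb (F j s z)).2
      rw [Finset.sum_neg_distrib] at h5
      linarith
    exact ge_of_tendsto' ((hsum s hs₁ z).hasSum.tendsto_sum_nat.const_add _) hpart
  have hstep : ∀ T, T ≤ T₁ → (∀ x, 0 ≤ q T x) → ∀ t, 0 ≤ t → T - τ ≤ t → t < T →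
      ∀ x, 0 ≤ q t x := by
    intro T hT hqT' t ht0 htτ htT x
    have hiter : ∀ n : ℕ, ∀ s, 0 ≤ s → T - τ ≤ s → s < T → ∀ z,
        -(κ₀ / 2 ^ n * (T - s) ^ p * ‖z‖ ^ 2) ≤ a * q s (E s z) + ∑' j, q s (F j s z) := by
      intro n
      induction n with
      | zero =>
        intro s hs0 _ hsT z
        refine le_trans ?_ (hlow s ⟨hs0, hsT.trans_le hT⟩ z)
        have : (T₁ - s) ^ p ≤ (T - s) ^ p :=
          Real.rpow_le_rpow_of_nonpos (sub_pos.2 hsT) (by linarith) hp0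
        rw [pow_zero, div_one]
        gcongr
      | succ n ih =>
        have := hhalf T hT hqT' _ (by positivity) ih
        simpa only [pow_succ, div_div] using this
    have hzero : ∀ s ∈ Set.Ico t T, ∀ z,
        -(0 * (T - s) ^ p * ‖z‖ ^ 2) ≤ a * q s (E s z) + ∑' j, q s (F j s z) := by
      intro s hs z
      have hlim : Tendsto (fun n : ℕ => -(κ₀ / 2 ^ n * (T - s) ^ p * ‖z‖ ^ 2)) atTop
          (nhds (-(0 * (T - s) ^ p * ‖z‖ ^ 2))) := by
        have h0 : Tendsto (fun n : ℕ => κ₀ / 2 ^ n) atTop (nhds 0) :=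
          tendsto_const_nhds.div_atTop (tendsto_pow_atTop_atTop_of_one_lt one_lt_two)
        exact ((h0.mul_const _).mul_const _).neg
      exact le_of_tendsto' hlim fun n => hiter n s (ht0.trans hs.1) (htτ.trans hs.1) hs.2 z
    have := (neg_integral_le_of_jump_lower_bound hp ha le_rfl htT hT hS0 hScont
      (hq t ⟨ht0, htT.trans_le hT⟩) hqT' hzero x).2
    simpa using this
  have hind : ∀ n : ℕ, ∀ t ∈ Set.Icc 0 T₁, T₁ - n * τ ≤ t → ∀ x, 0 ≤ q t x := by
    intro n
    induction n with
    | zero =>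
      intro t ht htn
      have : t = T₁ := le_antisymm ht.2 (by simpa using htn)
      exact this ▸ hqT
    | succ n ih =>
      intro t ht htn
      rcases le_or_gt (T₁ - n * τ) t with h | h
      · exact ih t ht h
      · push_cast at htn
        refine hstep (T₁ - n * τ) ?_ (ih _ ⟨ht.1.trans h.le, ?_⟩ le_rfl) t ht.1 (by linarith) h
        all_goals exact sub_le_self _ (by positivity)
  intro t ht
  obtain ⟨n, hn⟩ := exists_nat_gt (T₁ / τ)
  rw [div_lt_iff₀ hτ0] at hn
  exact hind n t ht (by linarith [ht.1])

end Comparison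

section Riccati

variable {H U : Type*}
  [NormedAddCommGroup H] [InnerProductSpace ℝ H] [CompleteSpace H]
  [NormedAddCommGroup U] [InnerProductSpace ℝ U]

set_option maxHeartbeats 1000000 in
/-- Comparison of two solutions with different horizons, up to a factor `1 + ε`. The slack in the
control cost allows the drift of the feedback to be replaced by the jump `z ↦ z + h B λ z`. -/
theorem IsRiccatiEnergy.inner_le_one_add_mul
    {α c δ ε T₁ T₂ M₁ K₁ M₂ K₂ : ℝ} (hα0 : 0 < α) (hα : α < 1 / 2) (hc : 0 < c) (hδ : 0 < δ)
    (hε : 0 < ε) (hT₁ : 0 < T₁) (hT : T₁ < T₂) (hM₁ : 0 ≤ M₁) (hK₁ : 0 ≤ K₁) (hM₂ : 0 ≤ M₂)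
    (hK₂ : 0 ≤ K₂) {S : ℝ → H →L[ℝ] H} (hS0 : S 0 = ContinuousLinearMap.id ℝ H)
    (hScont : ∀ x : H, ContinuousOn (fun t => S t x) (Set.Ici (0 : ℝ)))
    {B : U →L[ℝ] H} {C : ℕ → H →L[ℝ] H} {D : ℕ → U →L[ℝ] H}
    {Q : H →L[ℝ] H} {R : U →L[ℝ] U} (hQpos : ∀ x : H, 0 ≤ ⟪Q x, x⟫)
    (hRcoer : ∀ v : U, δ * ‖v‖ ^ 2 ≤ ⟪R v, v⟫)
    (hSC : ∀ t : ℝ, 0 < t → ∀ x : H,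
      (Summable fun j => ‖S t (C j x)‖ ^ 2) ∧
      (∑' j, ‖S t (C j x)‖ ^ 2) ≤ c * t ^ (-2 * α) * ‖x‖ ^ 2)
    (hD : ∀ v : U, (Summable fun j => ‖D j v‖ ^ 2) ∧ (∑' j, ‖D j v‖ ^ 2) ≤ c * ‖v‖ ^ 2)
    {P₁ P₂ : ℝ → H →L[ℝ] H} {lam₁ lam₂ : ℝ → H →L[ℝ] U} {G₁ G₂ : ℝ → H → ℝ}
    (h₁ : IsRiccatiEnergy T₁ α M₁ K₁ S B C D Q R P₁ lam₁ G₁)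
    (h₂ : IsRiccatiEnergy T₂ α M₂ K₂ S B C D Q R P₂ lam₂ G₂) :
    ∀ t ∈ Set.Icc (0 : ℝ) T₁, ∀ x, ⟪P₁ t x, x⟫ ≤ (1 + ε) * ⟪P₂ t x, x⟫ := by
  have hp1 : -1 < -2 * α := by linarith
  have hp0 : -2 * α ≤ 0 := by linarith
  obtain ⟨N, hN0, hN⟩ := exists_norm_le_of_continuousOn_Icc (P := S) (a := 0) (b := T₁)
    fun x => (hScont x).mono Set.Icc_subset_Ici_self
  have hIcc : ∀ {s}, s ∈ Set.Ico (0 : ℝ) T₁ → s ∈ Set.Icc (0 : ℝ) T₁ := fun h => ⟨h.1, h.2.le⟩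
  have hIco₂ : ∀ {s}, s ∈ Set.Ico (0 : ℝ) T₁ → s ∈ Set.Ico (0 : ℝ) T₂ :=
    fun h => ⟨h.1, h.2.trans hT⟩
  have hIcc₂ : ∀ {s}, s ∈ Set.Icc (0 : ℝ) T₁ → s ∈ Set.Icc (0 : ℝ) T₂ :=
    fun h => ⟨h.1, h.2.trans hT.le⟩
  set b : ℝ := K₂ * (T₂ - T₁) ^ (-2 * α) with hb
  have hb0 : 0 ≤ b := mul_nonneg hK₂ (Real.rpow_nonneg (sub_nonneg.2 hT.le) _)
  have hgain : ∀ s ∈ Set.Ico (0 : ℝ) T₁, ∀ z, ‖lam₂ s z‖ ^ 2 ≤ b * ‖z‖ ^ 2 := by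
    intro s hs z
    refine (h₂.gain_le s (hIco₂ hs) z).trans ?_
    rw [hb]
    gcongr ?_ * _
    exact mul_le_mul_of_nonneg_left
      (Real.rpow_le_rpow_of_nonpos (sub_pos.2 hT) (by linarith [hs.2]) hp0) hK₂
  set h : ℝ := ε * δ / ((1 + ε) * M₂ * ‖B‖ ^ 2 + 1) with hh
  have hhpos : 0 < h := by positivity
  have hhle : h * ((1 + ε) * M₂ * ‖B‖ ^ 2) ≤ ε * δ := by
    rw [hh, div_mul_eq_mul_div, div_le_iff₀ (by positivity)]
    nlinarith [mul_pos hε hδ]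
  set q : ℝ → H → ℝ := fun s x => (1 + ε) * ⟪P₂ s x, x⟫ - ⟪P₁ s x, x⟫ with hq
  set E : ℝ → H → H := fun s z => z + h • B (lam₂ s z) with hE
  set F : ℕ → ℝ → H → H := fun j s z => C j z + D j (lam₂ s z) with hF
  set e : ℝ := 2 + 2 * (h ^ 2 * ‖B‖ ^ 2 * b) with he
  have he0 : 0 ≤ e := by positivity
  have hEle : ∀ s ∈ Set.Ico (0 : ℝ) T₁, ∀ z, ‖E s z‖ ^ 2 ≤ e * ‖z‖ ^ 2 := by
    intro s hs z
    have e1 : ‖E s z‖ ≤ ‖z‖ + h * (‖B‖ * ‖lam₂ s z‖) := by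
      refine (norm_add_le _ _).trans ?_
      rw [norm_smul, Real.norm_of_nonneg hhpos.le]
      gcongr
      exact B.le_opNorm _
    calc ‖E s z‖ ^ 2 ≤ (‖z‖ + h * (‖B‖ * ‖lam₂ s z‖)) ^ 2 := by gcongr
      _ ≤ 2 * ‖z‖ ^ 2 + 2 * (h * (‖B‖ * ‖lam₂ s z‖)) ^ 2 := by
        nlinarith [sq_nonneg (‖z‖ - h * (‖B‖ * ‖lam₂ s z‖))]
      _ = 2 * ‖z‖ ^ 2 + 2 * (h ^ 2 * ‖B‖ ^ 2 * ‖lam₂ s z‖ ^ 2) := by ring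
      _ ≤ 2 * ‖z‖ ^ 2 + 2 * (h ^ 2 * ‖B‖ ^ 2 * (b * ‖z‖ ^ 2)) := by
        gcongr
        exact hgain s hs z
      _ = _ := by rw [he]; ring
  have hDle : ∀ s ∈ Set.Ico (0 : ℝ) T₁, ∀ z,
      (∑' j, ‖D j (lam₂ s z)‖ ^ 2) ≤ c * b * ‖z‖ ^ 2 := fun s hs z =>
    (hD _).2.trans (by rw [mul_assoc]; gcongr; exact hgain s hs z)
  have hsum₁ : ∀ s ∈ Set.Ico (0 : ℝ) T₁, ∀ z, Summable fun j => ⟪P₁ s (F j s z), F j s z⟫ :=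
    fun s hs z => h₁.summable_control s hs z _
  have hsum₂ : ∀ s ∈ Set.Ico (0 : ℝ) T₁, ∀ z, Summable fun j => ⟪P₂ s (F j s z), F j s z⟫ :=
    fun s hs z => h₂.summable_control s (hIco₂ hs) z _
  have hqtsum : ∀ s ∈ Set.Ico (0 : ℝ) T₁, ∀ z, ∑' j, q s (F j s z)
      = (1 + ε) * (∑' j, ⟪P₂ s (F j s z), F j s z⟫) - ∑' j, ⟪P₁ s (F j s z), F j s z⟫ := by
    intro s hs z
    rw [← tsum_mul_left, ← Summable.tsum_sub ((hsum₂ s hs z).mul_left _) (hsum₁ s hs z)]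
  have hdiff : ∀ s ∈ Set.Ico (0 : ℝ) T₁, ∀ z, -(h⁻¹ * q s z) + (h⁻¹ * q s (E s z)
      + ∑' j, q s (F j s z)) ≤ (1 + ε) * G₂ s z - G₁ s z := by
    intro s hs z
    set v := lam₂ s z with hv
    have e1 := h₁.le_control s hs z v
    have e2 := h₂.eq_feedback s (hIco₂ hs) z
    rw [hqtsum s hs z, e2]
    have e3 : h⁻¹ * q s (E s z) = h⁻¹ * q s z
        + 2 * ((1 + ε) * ⟪P₂ s z, B v⟫ - ⟪P₁ s z, B v⟫) + h * q s (B v) := by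
      simp only [hq, hE, inner_map_add_self (h₁.selfAdjoint s (hIcc hs)),
        inner_map_add_self (h₂.selfAdjoint s (hIcc₂ (hIcc hs))), map_smul, inner_smul_left,
        inner_smul_right, RCLike.conj_to_real, ← hv]
      field_simp
      ring
    have e4 : h * q s (B v) ≤ ε * ⟪R v, v⟫ := by
      have i1 := h₁.nonneg s (hIcc hs) (B v)
      have i2 := h₂.le s (hIcc₂ (hIcc hs)) (B v)
      have i3 : ‖B v‖ ^ 2 ≤ ‖B‖ ^ 2 * ‖v‖ ^ 2 := by
        rw [← mul_pow]; gcongr; exact B.le_opNorm v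
      calc h * q s (B v) ≤ h * ((1 + ε) * (M₂ * (‖B‖ ^ 2 * ‖v‖ ^ 2))) := by
            simp only [hq]
            gcongr
            have : (1 + ε) * ⟪P₂ s (B v), B v⟫ ≤ (1 + ε) * (M₂ * (‖B‖ ^ 2 * ‖v‖ ^ 2)) := by
              gcongr
              exact i2.trans (by gcongr)
            linarith
        _ = h * ((1 + ε) * M₂ * ‖B‖ ^ 2) * ‖v‖ ^ 2 := by ring
        _ ≤ ε * δ * ‖v‖ ^ 2 := by gcongr
        _ = ε * (δ * ‖v‖ ^ 2) := by ring
        _ ≤ _ := by gcongr; exact hRcoer v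
    have e5 := mul_nonneg hε.le (hQpos z)
    simp only [hF, ← hv] at e1 ⊢
    rw [e3]
    linarith
  have hfinal := nonneg_of_backward_smoothing (S := S) (q := q) (E := E) (F := F) (a := h⁻¹)
    (p := -2 * α) (T₁ := T₁)
    (κ₀ := (M₁ * e * h⁻¹ + 2 * (M₁ * (c * b))) * T₁ ^ (-(-2 * α)) + 2 * K₁)
    (k := (h⁻¹ * (N ^ 2 * e) + 2 * (N ^ 2 * (c * b))) * T₁ ^ (-(-2 * α)) + 2 * c)
    hp1 hp0 (by positivity) (by positivity) (by positivity) hS0 hScont ?_ ?_ ?_ ?_ ?_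
  · intro t ht x
    have := hfinal t ht x
    simp only [hq] at this
    linarith
  · intro t ht x
    have i₁ := h₁.integrable t (hIcc ht) x
    have i₂ := h₂.integrable t (hIcc₂ (hIcc ht)) x
    have i₂sub : ∀ {u v}, t ≤ u → u ≤ v → v ≤ T₂ →
        IntervalIntegrable (fun s => G₂ s (S (s - t) x)) volume u v := fun a1 a2 a3 =>
      i₂.mono_set (by
        rw [Set.uIcc_of_le (a1.trans (a2.trans a3)), Set.uIcc_of_le a2]
        exact Set.Icc_subset_Icc a1 a3)
    refine ⟨fun s => (1 + ε) * G₂ s (S (s - t) x) - G₁ s (S (s - t) x),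
      ((i₂sub le_rfl ht.2.le hT.le).const_mul _).sub i₁, fun s hs => ?_,
      fun s hs => hdiff s ⟨ht.1.trans hs.1, hs.2⟩ _⟩
    have i₁s : IntervalIntegrable (fun s => G₁ s (S (s - t) x)) volume s T₁ :=
      i₁.mono_set (by
        rw [Set.uIcc_of_le ht.2.le, Set.uIcc_of_le hs.2]; exact Set.Icc_subset_Icc_left hs.1)
    have e1 := h₁.energy t (hIcc ht) s hs x
    have e2 := h₁.energy t (hIcc ht) T₁ ⟨ht.2.le, le_rfl⟩ x
    have e3 := h₂.energy t (hIcc₂ (hIcc ht)) s ⟨hs.1, hs.2.trans hT.le⟩ x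
    have e4 := h₂.energy t (hIcc₂ (hIcc ht)) T₁ ⟨ht.2.le, hT.le⟩ x
    have e5 := intervalIntegral.integral_add_adjacent_intervals (i₂sub hs.1 hs.2 hT.le)
      (i₂sub ht.2.le hT.le le_rfl)
    rw [intervalIntegral.integral_same] at e2
    rw [intervalIntegral.integral_sub ((i₂sub hs.1 hs.2 hT.le).const_mul _) i₁s,
      intervalIntegral.integral_const_mul]
    simp only [hq]
    rw [e1, e2, e3, e4, ← e5]
    ring
  · intro x
    have e1 := h₁.energy T₁ ⟨hT₁.le, le_rfl⟩ T₁ ⟨le_rfl, le_rfl⟩ x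
    simp only [sub_self, hS0, intervalIntegral.integral_same, ContinuousLinearMap.id_apply] at e1
    have e2 := h₂.nonneg T₁ ⟨hT₁.le, hT.le⟩ x
    simp only [hq, e1, sub_zero]
    positivity
  · intro s hs z
    exact ((hsum₂ s hs z).mul_left _).sub (hsum₁ s hs z)
  · intro s hs z
    rw [hqtsum s hs z]
    have hr := Real.rpow_nonneg (sub_nonneg.2 hs.2.le) (-2 * α)
    have e1 : -(M₁ * (e * ‖z‖ ^ 2)) ≤ q s (E s z) := by
      have i1 := h₁.le s (hIcc hs) (E s z)
      have i2 := h₂.nonneg s (hIcc₂ (hIcc hs)) (E s z)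
      have i3 := mul_le_mul_of_nonneg_left (hEle s hs z) hM₁
      have i4 : 0 ≤ (1 + ε) * ⟪P₂ s (E s z), E s z⟫ := by positivity
      simp only [hq]
      linarith
    have e2 := mul_le_mul_of_nonneg_left e1 (inv_nonneg.2 hhpos.le)
    have e3 : 0 ≤ (1 + ε) * ∑' j, ⟪P₂ s (F j s z), F j s z⟫ :=
      mul_nonneg (by positivity) (tsum_nonneg fun j => h₂.nonneg s (hIcc₂ (hIcc hs)) _)
    have e4 : ∑' j, ⟪P₁ s (F j s z), F j s z⟫
        ≤ 2 * (K₁ * (T₁ - s) ^ (-2 * α) * ‖z‖ ^ 2) + 2 * (M₁ * (c * b * ‖z‖ ^ 2)) := by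
      have d1 := (hD (lam₂ s z)).1.mul_left M₁
      have hle := Summable.tsum_le_tsum (fun j => (inner_map_add_self_le
        (h₁.selfAdjoint s (hIcc hs)) (h₁.nonneg s (hIcc hs)) (C j z) (D j (lam₂ s z))).trans
          (add_le_add_right (mul_le_mul_of_nonneg_left (h₁.le s (hIcc hs) (D j (lam₂ s z)))
            zero_le_two) _)) (hsum₁ s hs z)
        (((h₁.summable s hs z).mul_left 2).add (d1.mul_left 2))
      rw [Summable.tsum_add ((h₁.summable s hs z).mul_left 2) (d1.mul_left 2), tsum_mul_left,
        tsum_mul_left, tsum_mul_left] at hle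
      refine hle.trans ?_
      gcongr
      · exact h₁.tsum_le s hs z
      · exact hDle s hs z
    have e5 := one_le_rpow_neg_mul_rpow hp0 (sub_pos.2 hs.2) (sub_le_self T₁ hs.1)
    have e6 := mul_le_mul_of_nonneg_left e5
      (show 0 ≤ (M₁ * e * h⁻¹ + 2 * (M₁ * (c * b))) * ‖z‖ ^ 2 by positivity)
    linarith
  · intro s r hs0 hsr hr z n
    have hs : s ∈ Set.Ico (0 : ℝ) T₁ := ⟨hs0, hsr.trans_le hr⟩
    have hrs : 0 < r - s := sub_pos.2 hsr
    have hSn : ∀ y, ‖S (r - s) y‖ ^ 2 ≤ N ^ 2 * ‖y‖ ^ 2 := fun y => by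
      rw [← mul_pow]
      gcongr
      exact (S (r - s)).le_of_opNorm_le (hN _ ⟨hrs.le, by linarith⟩) y
    have e1 : ‖S (r - s) (E s z)‖ ^ 2 ≤ N ^ 2 * (e * ‖z‖ ^ 2) :=
      (hSn _).trans (by gcongr; exact hEle s hs z)
    have e2 := mul_le_mul_of_nonneg_left e1 (inv_nonneg.2 hhpos.le)
    have e3 : ∑ j ∈ Finset.range n, ‖S (r - s) (F j s z)‖ ^ 2
        ≤ 2 * (c * (r - s) ^ (-2 * α) * ‖z‖ ^ 2) + 2 * (N ^ 2 * (c * b * ‖z‖ ^ 2)) := by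
      calc ∑ j ∈ Finset.range n, ‖S (r - s) (F j s z)‖ ^ 2
          ≤ ∑ j ∈ Finset.range n, (2 * ‖S (r - s) (C j z)‖ ^ 2
            + 2 * (N ^ 2 * ‖D j (lam₂ s z)‖ ^ 2)) := by
            refine Finset.sum_le_sum fun j _ => ?_
            have i1 : ‖S (r - s) (F j s z)‖
                ≤ ‖S (r - s) (C j z)‖ + ‖S (r - s) (D j (lam₂ s z))‖ := by
              simp only [hF, map_add]
              exact norm_add_le _ _
            have i2 := hSn (D j (lam₂ s z))
            have i3 := pow_le_pow_left₀ (norm_nonneg _) i1 2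
            nlinarith [sq_nonneg (‖S (r - s) (C j z)‖ - ‖S (r - s) (D j (lam₂ s z))‖)]
        _ = 2 * (∑ j ∈ Finset.range n, ‖S (r - s) (C j z)‖ ^ 2)
            + 2 * (N ^ 2 * ∑ j ∈ Finset.range n, ‖D j (lam₂ s z)‖ ^ 2) := by
            rw [Finset.sum_add_distrib, Finset.mul_sum, Finset.mul_sum, Finset.mul_sum]
        _ ≤ _ := by
            gcongr
            · exact ((hSC _ hrs z).1.sum_le_tsum _ fun _ _ => sq_nonneg _).trans (hSC _ hrs z).2
            · exact ((hD _).1.sum_le_tsum _ fun _ _ => sq_nonneg _).trans (hDle s hs z)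
    have e5 := one_le_rpow_neg_mul_rpow hp0 hrs (show r - s ≤ T₁ by linarith)
    have e6 := mul_le_mul_of_nonneg_left e5
      (show 0 ≤ (h⁻¹ * (N ^ 2 * e) + 2 * (N ^ 2 * (c * b))) * ‖z‖ ^ 2 by positivity)
    linarith

end Riccati

/-- for time-invariant coefficients, the unique mild solutions `P^{(T)}` of
the Riccati equations with terminal value `0` satisfying the singular bound are
non-decreasing in the horizon: for `0 < T₁ ≤ T₂` and `t ∈ [0,T₁]`, `P^{(T₁)}_t ≤ P^{(T₂)}_t`. -/
theorem stmt17
    {H U : Type*}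
    [NormedAddCommGroup H] [InnerProductSpace ℝ H] [CompleteSpace H]
    [NormedAddCommGroup U] [InnerProductSpace ℝ U] [CompleteSpace U]
    (α c δ : ℝ) (hα0 : 0 < α) (hα : α < 1 / 2) (hc : 0 < c) (hδ : 0 < δ)
    (S : ℝ → H →L[ℝ] H)
    (hS0 : S 0 = ContinuousLinearMap.id ℝ H)
    (hSadd : ∀ s t : ℝ, 0 ≤ s → 0 ≤ t → S (s + t) = (S s).comp (S t))
    (hScont : ∀ x : H, ContinuousOn (fun t => S t x) (Set.Ici (0 : ℝ)))
    (B : U →L[ℝ] H) (C : ℕ → H →L[ℝ] H) (D : ℕ → U →L[ℝ] H)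
    (Q : H →L[ℝ] H) (R : U →L[ℝ] U)
    (hQsa : IsSelfAdjoint Q) (hQpos : ∀ x : H, 0 ≤ ⟪Q x, x⟫)
    (hRsa : IsSelfAdjoint R)
    (hRcoer : ∀ v : U, δ * ‖v‖ ^ 2 ≤ ⟪R v, v⟫)
    (hSC : ∀ t : ℝ, 0 < t → ∀ x : H,
      (Summable fun j => ‖S t (C j x)‖ ^ 2) ∧
      (∑' j, ‖S t (C j x)‖ ^ 2) ≤ c * t ^ (-2 * α) * ‖x‖ ^ 2)
    (hD : ∀ v : U, (Summable fun j => ‖D j v‖ ^ 2) ∧ (∑' j, ‖D j v‖ ^ 2) ≤ c * ‖v‖ ^ 2)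
    (P : ℝ → ℝ → H →L[ℝ] H)
    (hP : ∀ T : ℝ, 0 < T →
      IsRiccatiMildSolutionTI T S B C D Q R (P T) ∧ RiccatiSingularBoundTI T α C (P T)) :
    ∀ T₁ T₂ : ℝ, 0 < T₁ → T₁ ≤ T₂ →
      ∀ t ∈ Set.Icc (0 : ℝ) T₁, ∀ x : H, ⟪P T₁ t x, x⟫ ≤ ⟪P T₂ t x, x⟫ := by
  intro T₁ T₂ hT₁ hT t ht x
  rcases hT.eq_or_lt with rfl | hlt
  · exact le_rfl
  obtain ⟨M₁, K₁, lam₁, G₁, hM₁, hK₁, h₁⟩ := (hP T₁ hT₁).1.exists_isRiccatiEnergy hα0 hα hc hδ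
    hT₁ hSadd hScont hRsa hRcoer hD (hP T₁ hT₁).2
  obtain ⟨M₂, K₂, lam₂, G₂, hM₂, hK₂, h₂⟩ := (hP T₂ (hT₁.trans hlt)).1.exists_isRiccatiEnergy
    hα0 hα hc hδ (hT₁.trans hlt) hSadd hScont hRsa hRcoer hD (hP T₂ (hT₁.trans hlt)).2
  have hlim : Tendsto (fun ε : ℝ => (1 + ε) * ⟪P T₂ t x, x⟫) (nhdsWithin 0 (Set.Ioi 0))
      (nhds ⟪P T₂ t x, x⟫) := by
    have : Tendsto (fun ε : ℝ => (1 + ε) * ⟪P T₂ t x, x⟫) (nhds 0)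
        (nhds ((1 + 0) * ⟪P T₂ t x, x⟫)) := Continuous.tendsto (by fun_prop) 0
    rw [add_zero, one_mul] at this
    exact this.mono_left nhdsWithin_le_nhds
  refine ge_of_tendsto hlim ?_
  filter_upwards [self_mem_nhdsWithin] with ε hε
  exact h₁.inner_le_one_add_mul hα0 hα hc hδ hε hT₁ hlt hM₁ hK₁ hM₂ hK₂ hS0 hScont hQpos hRcoer
    hSC hD h₂ t ht x
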